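/- Let n ≥ 1 and a : Fin n → ℕ with a i > 0 for all i, and set s = ∑ i, a i. Let K(k) = (k·s)! / ∏ i, (k·(a i))! be the number of sequences of length T = k·s in which letter i occurs exactly k·(a i) times. Then lim_{k→∞} (log K(k)) / (k·s) = −∑ i, (a i / s) · log (a i / s). -/

import Mathlib

open Finset Filter Real

/-- Stirling's formula on the logarithmic scale: `log m! = m log m - m + o(m)`. -/
theorem tendsto_log_factorial_div_sub_log :
    Tendsto (fun m : ℕ => Real.log (m.factorial : ℝ) / m - Real.log m) atTop (nhds (-1)) := by
  have hcast : Tendsto (fun m : ℕ => (m : ℝ)) atTop atTop := tendsto_natCast_atTop_atTop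
  have hseq : Tendsto (fun m : ℕ => Real.log (Stirling.stirlingSeq m) / m) atTop (nhds 0) :=
    (Stirling.tendsto_stirlingSeq_sqrt_pi.log (by positivity)).div_atTop hcast
  have hlog : Tendsto (fun m : ℕ => Real.log m / m) atTop (nhds 0) :=
    Real.isLittleO_log_id_atTop.tendsto_div_nhds_zero.comp hcast
  have htwo : Tendsto (fun m : ℕ => Real.log 2 / m) atTop (nhds 0) :=
    tendsto_const_nhds.div_atTop hcast
  have hsum := ((hseq.add ((htwo.add hlog).const_mul (1 / 2))).sub_const 1)
  norm_num at hsum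
  refine hsum.congr' ?_
  filter_upwards [eventually_gt_atTop 0] with m hm
  have hm' : (m : ℝ) ≠ 0 := by positivity
  rw [Stirling.log_stirlingSeq_formula, Real.log_mul two_ne_zero hm',
    Real.log_div hm' (Real.exp_ne_zero 1), Real.log_exp]
  field_simp
  ring

theorem stmt_2 (n : ℕ) (hn : 1 ≤ n) (a : Fin n → ℕ) (ha : ∀ i, 0 < a i)
    (s : ℕ) (hs : s = ∑ i, a i) :
    Filter.Tendsto
      (fun k : ℕ =>
        Real.log (((k * s).factorial : ℝ) / ∏ i, ((k * a i).factorial : ℝ)) / (k * s : ℝ))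
      Filter.atTop
      (nhds (-∑ i, ((a i : ℝ) / (s : ℝ)) * Real.log ((a i : ℝ) / (s : ℝ)))) := by
  have hs0 : 0 < s := hs ▸ Finset.sum_pos (fun i _ => ha i) ⟨⟨0, hn⟩, mem_univ _⟩
  have hsR : (s : ℝ) ≠ 0 := by positivity
  have hsum : ∑ i, (a i : ℝ) / s = 1 := by
    rw [← Finset.sum_div, ← Nat.cast_sum, ← hs, div_self hsR]
  have hmul : ∀ b : ℕ, 0 < b → Tendsto
      (fun k : ℕ => Real.log ((k * b).factorial : ℝ) / (k * b : ℕ) - Real.log (k * b : ℕ))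
      atTop (nhds (-1)) := fun b hb =>
    tendsto_log_factorial_div_sub_log.comp (tendsto_id.atTop_mul_const' hb)
  have hlim := ((hmul s hs0).sub (tendsto_finsetSum univ fun i _ =>
    (hmul (a i) (ha i)).const_mul ((a i : ℝ) / s))).add_const
      (-∑ i, ((a i : ℝ) / (s : ℝ)) * Real.log ((a i : ℝ) / (s : ℝ)))
  rw [← Finset.sum_mul, hsum, one_mul, sub_self, zero_add] at hlim
  refine hlim.congr' ?_
  filter_upwards [eventually_gt_atTop 0] with k hk
  have hkR : (k : ℝ) ≠ 0 := by positivity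
  have hterm : ∀ i, (a i : ℝ) / s *
      (Real.log ((k * a i).factorial : ℝ) / (k * a i : ℕ) - Real.log (k * a i : ℕ)) =
      Real.log ((k * a i).factorial : ℝ) / (k * s) - (a i : ℝ) / s * Real.log (k * s) -
        (a i : ℝ) / s * Real.log ((a i : ℝ) / s) := fun i => by
    have hai : (a i : ℝ) ≠ 0 := by exact_mod_cast (ha i).ne'
    push_cast
    rw [Real.log_mul hkR hai, Real.log_mul hkR hsR, Real.log_div hai hsR]
    field_simp
    ring
  rw [Finset.sum_congr rfl fun i _ => hterm i, Finset.sum_sub_distrib, Finset.sum_sub_distrib,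
    ← Finset.sum_mul, hsum, ← Finset.sum_div,
    Real.log_div (by positivity) (by positivity),
    Real.log_prod (fun i _ => by positivity)]
  push_cast
  ring
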